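/- The matrix elements of the modified R-operator R_k(ξ) in the theta basis are R_k(ξ)_{ac,bd} = δ_{a+b,c+d}·θ₁((μ−ξ−a+b)/k, τ/k)·θ₁′(0, τ/k) / (k·θ₁((μ−a+c)/k, τ/k)·θ₁((ξ−b+c)/k, τ/k)), i.e., Belavin's ℤ_k-symmetric R-matrix: R_k(ξ)(θ_a⊗θ_b) = Σ_{c,d∈ℤ_k} R_k(ξ)_{ac,bd} θ_c⊗θ_d. -/

import Mathlib

open Complex

/-- Jacobi theta function `θ₁(z,τ) = Σ_{n∈ℤ+1/2} exp(iπn²τ + 2πin(z+1/2))`. -/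
noncomputable def theta1 (z τ : ℂ) : ℂ :=
  ∑' n : ℤ, Complex.exp (Real.pi * I * ((n : ℂ) + 1/2)^2 * τ +
    2 * Real.pi * I * ((n : ℂ) + 1/2) * (z + 1/2))

/-- `θ₁′(0,τ)`, the derivative of `θ₁` in the first variable at `0`. -/
noncomputable def theta1'0 (τ : ℂ) : ℂ := deriv (fun w => theta1 w τ) 0

/-- The function `σ_μ(z) = θ₁(z−μ,τ)θ₁′(0,τ)/(θ₁(z,τ)θ₁(−μ,τ))`. -/
noncomputable def sigmaE (τ μ z : ℂ) : ℂ :=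
  theta1 (z - μ) τ * theta1'0 τ / (theta1 z τ * theta1 (-μ) τ)

/-- The lattice `ℤ + τℤ`. -/
def lattice (τ : ℂ) : Set ℂ := {w | ∃ m n : ℤ, w = (m : ℂ) + (n : ℂ) * τ}

/-- Theta basis of V_k: θ_a(z) = Σ_{n∈ℤ} exp(πin²τ/k + 2πin(z − a/k)), a ∈ ℤ/kℤ. -/
noncomputable def thetaA (τ : ℂ) (k : ℕ) (a : ZMod k) (z : ℂ) : ℂ :=
  ∑' n : ℤ, Complex.exp (Real.pi * I * (n : ℂ) ^ 2 * τ / k +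
    2 * Real.pi * I * (n : ℂ) * (z - (a.val : ℂ) / k))

/-- Belavin's ℤ_k-symmetric R-matrix elements
R_k(ξ)_{ac,bd} = δ_{a+b,c+d} θ₁((μ−ξ−a+b)/k, τ/k) θ₁′(0, τ/k) /
(k θ₁((μ−a+c)/k, τ/k) θ₁((ξ−b+c)/k, τ/k)). -/
noncomputable def belavinR (τ : ℂ) (k : ℕ) (μ ξ : ℂ) (a b c d : ZMod k) : ℂ :=
  (if a + b = c + d then 1 else 0) *
    theta1 ((μ - ξ - (a.val : ℂ) + (b.val : ℂ)) / k) (τ / k) * theta1'0 (τ / k) /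
    ((k : ℂ) * theta1 ((μ - (a.val : ℂ) + (c.val : ℂ)) / k) (τ / k) *
      theta1 ((ξ - (b.val : ℂ) + (c.val : ℂ)) / k) (τ / k))

lemma theta1_eq_jacobiTheta₂ (z τ : ℂ) :
    theta1 z τ = exp (Real.pi * I * τ / 4 + Real.pi * I * (z + 1 / 2)) *
      jacobiTheta₂ (z + 1 / 2 + τ / 2) τ := by
  rw [theta1, jacobiTheta₂, ← tsum_mul_left]
  refine tsum_congr fun n => ?_
  rw [jacobiTheta₂_term, ← Complex.exp_add]
  congr 1
  ring

lemma differentiable_theta1 {τ : ℂ} (hτ : 0 < τ.im) : Differentiable ℂ (fun z => theta1 z τ) := by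
  intro z
  simp only [theta1_eq_jacobiTheta₂]
  refine DifferentiableAt.mul (by fun_prop) ?_
  exact (differentiableAt_jacobiTheta₂_fst (z + 1 / 2 + τ / 2) hτ).comp z
    (f := fun z => z + 1 / 2 + τ / 2) (by fun_prop)

lemma Complex.exp_int_add_half (n : ℤ) : exp (2 * Real.pi * I * ((n : ℂ) + 1 / 2)) = -1 := by
  rw [show 2 * Real.pi * I * ((n : ℂ) + 1 / 2) = Real.pi * I + n * (2 * Real.pi * I) by ring,
    Complex.exp_add, Complex.exp_int_mul_two_pi_mul_I, Complex.exp_pi_mul_I, mul_one]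

lemma theta1_neg (z τ : ℂ) : theta1 (-z) τ = -theta1 z τ := by
  rw [theta1, theta1, ← (Equiv.subLeft (-1 : ℤ)).tsum_eq, ← tsum_neg]
  refine tsum_congr fun n => ?_
  rw [Equiv.subLeft_apply, neg_eq_neg_one_mul (exp _), ← Complex.exp_int_add_half (-1 - n),
    ← Complex.exp_add]
  congr 1
  push_cast
  ring

lemma theta1_zero (τ : ℂ) : theta1 0 τ = 0 := by
  have h := theta1_neg 0 τ
  rw [neg_zero] at h
  exact self_eq_neg.mp h

lemma jacobiTheta₂_sub_intCast (z τ : ℂ) (n : ℤ) :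
    jacobiTheta₂ (z - n) τ = jacobiTheta₂ z τ := by
  have h : Function.Periodic (fun z => jacobiTheta₂ z τ) 1 := fun z => jacobiTheta₂_add_left z τ
  simpa using h.sub_int_mul_eq (x := z) n

lemma thetaA_eq_jacobiTheta₂ (τ : ℂ) (k : ℕ) [NeZero k] (j : ℤ) (z : ℂ) :
    thetaA τ k (j : ZMod k) z = jacobiTheta₂ (z - j / k) (τ / k) := by
  have hk : (k : ℂ) ≠ 0 := NeZero.ne _
  have h1 : ((j : ZMod k).val : ℂ) = j - k * (j / (k : ℤ) : ℤ) := by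
    have h : (((j : ZMod k).val : ℤ) : ℂ) = ((j - k * (j / (k : ℤ)) : ℤ) : ℂ) := by
      rw [ZMod.val_intCast, Int.emod_def]
    push_cast at h
    exact h
  have h2 : z - j / k = (z - ((j : ZMod k).val : ℂ) / k) - (j / (k : ℤ) : ℤ) := by
    rw [h1]
    field_simp
    ring
  rw [h2, jacobiTheta₂_sub_intCast, thetaA, jacobiTheta₂]
  refine tsum_congr fun n => ?_
  rw [jacobiTheta₂_term]
  congr 1
  ring

lemma HasSum.mul_of_complex {f g : ℤ → ℂ} {a b : ℂ} (hf : HasSum f a) (hg : HasSum g b) :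
    HasSum (fun p : ℤ × ℤ => f p.1 * g p.2) (a * b) := by
  have h : Summable (fun p : ℤ × ℤ => f p.1 * g p.2) :=
    summable_mul_of_summable_norm hf.summable.norm hg.summable.norm
  exact hf.mul hg h

lemma hasSum_jacobiTheta₂_mul (u v : ℂ) {σ : ℂ} (hσ : 0 < σ.im) :
    HasSum (fun p : ℤ × ℤ => jacobiTheta₂_term p.1 u σ * jacobiTheta₂_term p.2 v σ)
      (jacobiTheta₂ u σ * jacobiTheta₂ v σ) :=
  HasSum.mul_of_complex (f := fun n => jacobiTheta₂_term n u σ)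
    (g := fun n => jacobiTheta₂_term n v σ)
    (hasSum_jacobiTheta₂_term u hσ) (hasSum_jacobiTheta₂_term v hσ)

/-- The addition formula for products of theta functions, obtained by splitting the double series
according to the parity of `m + n`. -/
lemma jacobiTheta₂_add_mul_sub (x y : ℂ) {τ : ℂ} (hτ : 0 < τ.im) :
    jacobiTheta₂ (x + y) τ * jacobiTheta₂ (x - y) τ =
      jacobiTheta₂ (2 * x) (2 * τ) * jacobiTheta₂ (2 * y) (2 * τ) +
      exp (Real.pi * I * τ + 2 * Real.pi * I * (x + y)) *
        (jacobiTheta₂ (2 * x + τ) (2 * τ) * jacobiTheta₂ (2 * y + τ) (2 * τ)) := by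
  have h2τ : 0 < (2 * τ).im := by simpa using hτ
  let e : ℤ × ℤ → ℤ × ℤ := fun p => (p.1 + p.2, p.1 - p.2)
  let o : ℤ × ℤ → ℤ × ℤ := fun p => (p.1 + p.2 + 1, p.1 - p.2)
  have he : Function.Injective e := by
    rintro ⟨a, b⟩ ⟨c, d⟩ h
    simp only [e, Prod.mk.injEq] at h ⊢
    omega
  have ho : Function.Injective o := by
    rintro ⟨a, b⟩ ⟨c, d⟩ h
    simp only [o, Prod.mk.injEq] at h ⊢
    omega
  have hcompl : IsCompl (Set.range e) (Set.range o) := by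
    rw [isCompl_iff]
    constructor
    · rw [Set.disjoint_left]
      rintro _ ⟨⟨a, b⟩, rfl⟩ ⟨⟨c, d⟩, h⟩
      simp only [e, o, Prod.mk.injEq] at h
      omega
    · rw [codisjoint_iff_le_sup]
      rintro ⟨m, n⟩ -
      rcases Int.even_or_odd' (m + n) with ⟨r, hr | hr⟩
      · left
        refine ⟨(r, m - r), ?_⟩
        simp only [e, Prod.mk.injEq]
        omega
      · right
        refine ⟨(r, m - r - 1), ?_⟩
        simp only [o, Prod.mk.injEq]
        omega
  let F : ℤ × ℤ → ℂ := fun p => jacobiTheta₂_term p.1 (x + y) τ * jacobiTheta₂_term p.2 (x - y) τ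
  have hF : HasSum F (jacobiTheta₂ (x + y) τ * jacobiTheta₂ (x - y) τ) :=
    hasSum_jacobiTheta₂_mul (x + y) (x - y) hτ
  have hFe : HasSum (F ∘ e) (jacobiTheta₂ (2 * x) (2 * τ) * jacobiTheta₂ (2 * y) (2 * τ)) := by
    refine (funext fun p => ?_ : _ = F ∘ e) ▸ hasSum_jacobiTheta₂_mul (2 * x) (2 * y) h2τ
    simp only [F, e, jacobiTheta₂_term, Function.comp_apply, ← Complex.exp_add]
    congr 1
    push_cast
    ring
  have hFo : HasSum (F ∘ o) (exp (Real.pi * I * τ + 2 * Real.pi * I * (x + y)) *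
      (jacobiTheta₂ (2 * x + τ) (2 * τ) * jacobiTheta₂ (2 * y + τ) (2 * τ))) := by
    refine (funext fun p => ?_ : _ = F ∘ o) ▸
      (hasSum_jacobiTheta₂_mul (2 * x + τ) (2 * y + τ) h2τ).mul_left
      (exp (Real.pi * I * τ + 2 * Real.pi * I * (x + y)))
    simp only [F, o, jacobiTheta₂_term, Function.comp_apply, ← Complex.exp_add]
    congr 1
    push_cast
    ring
  exact hF.unique (HasSum.add_isCompl (f := F) hcompl ((he.hasSum_range_iff (f := F)).mpr hFe)
    ((ho.hasSum_range_iff (f := F)).mpr hFo))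

/-- The odd companion of `z ↦ jacobiTheta₂ (2 * z) (2 * τ)` in the addition formulas. -/
noncomputable def oddTheta (τ z : ℂ) : ℂ :=
  exp (Real.pi * I * τ / 2 + 2 * Real.pi * I * z) * jacobiTheta₂ (2 * z + τ) (2 * τ)

lemma jacobiTheta₂_add_mul_sub' (x y : ℂ) {τ : ℂ} (hτ : 0 < τ.im) :
    jacobiTheta₂ (x + y) τ * jacobiTheta₂ (x - y) τ =
      jacobiTheta₂ (2 * x) (2 * τ) * jacobiTheta₂ (2 * y) (2 * τ) +
      oddTheta τ x * oddTheta τ y := by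
  rw [jacobiTheta₂_add_mul_sub x y hτ, oddTheta, oddTheta,
    show Real.pi * I * τ + 2 * Real.pi * I * (x + y) =
      (Real.pi * I * τ / 2 + 2 * Real.pi * I * x) + (Real.pi * I * τ / 2 + 2 * Real.pi * I * y) by
      ring, Complex.exp_add (_ + _)]
  ring

lemma theta1_add_mul_sub (x y : ℂ) {τ : ℂ} (hτ : 0 < τ.im) :
    theta1 (x + y) τ * theta1 (x - y) τ =
      jacobiTheta₂ (2 * x) (2 * τ) * oddTheta τ y - oddTheta τ x * jacobiTheta₂ (2 * y) (2 * τ) := by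
  have hE : jacobiTheta₂ (2 * (x + 1 / 2 + τ / 2)) (2 * τ) = jacobiTheta₂ (2 * x + τ) (2 * τ) := by
    rw [← jacobiTheta₂_add_left (2 * x + τ)]
    congr 1
    ring
  have hH : jacobiTheta₂ (2 * (x + 1 / 2 + τ / 2) + τ) (2 * τ) =
      exp (-Real.pi * I * (2 * τ + 2 * (2 * x))) * jacobiTheta₂ (2 * x) (2 * τ) := by
    rw [← jacobiTheta₂_add_left', ← jacobiTheta₂_add_left (2 * x + 2 * τ)]
    congr 1
    ring
  have h := jacobiTheta₂_add_mul_sub' (x + 1 / 2 + τ / 2) y hτ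
  rw [hE, oddTheta, hH] at h
  rw [theta1_eq_jacobiTheta₂, theta1_eq_jacobiTheta₂, mul_mul_mul_comm,
    show x + y + 1 / 2 + τ / 2 = x + 1 / 2 + τ / 2 + y by ring,
    show x - y + 1 / 2 + τ / 2 = x + 1 / 2 + τ / 2 - y by ring, h, oddTheta, oddTheta, mul_add]
  have e1 : exp (Real.pi * I * τ / 4 + Real.pi * I * (x + y + 1 / 2)) *
      exp (Real.pi * I * τ / 4 + Real.pi * I * (x - y + 1 / 2)) =
      -exp (Real.pi * I * τ / 2 + 2 * Real.pi * I * x) := by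
    rw [← Complex.exp_add, ← neg_one_mul, ← Complex.exp_pi_mul_I, ← Complex.exp_add]
    congr 1
    ring
  have e2 : exp (Real.pi * I * τ / 2 + 2 * Real.pi * I * x) *
      (exp (Real.pi * I * τ / 2 + 2 * Real.pi * I * (x + 1 / 2 + τ / 2)) *
        exp (-Real.pi * I * (2 * τ + 2 * (2 * x)))) = -1 := by
    rw [← Complex.exp_add, ← Complex.exp_add, ← Complex.exp_pi_mul_I]
    congr 1
    ring
  rw [e1]
  linear_combination (-jacobiTheta₂ (2 * x) (2 * τ) *
    (exp (Real.pi * I * τ / 2 + 2 * Real.pi * I * y) * jacobiTheta₂ (2 * y + τ) (2 * τ))) * e2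

/-- A three-term identity of Weierstrass type. -/
lemma theta_three_term (M X w₁ w₂ : ℂ) {τ : ℂ} (hτ : 0 < τ.im) :
    theta1 (w₁ - w₂ + M) τ * theta1 M τ *
        (jacobiTheta₂ (w₂ - X) τ * jacobiTheta₂ (w₁ + X) τ) -
      theta1 (w₁ - w₂ + X) τ * theta1 X τ *
        (jacobiTheta₂ (w₁ + M) τ * jacobiTheta₂ (w₂ - M) τ) =
    theta1 (w₁ - w₂ + M + X) τ * theta1 (M - X) τ *
      (jacobiTheta₂ w₁ τ * jacobiTheta₂ w₂ τ) := by
  have h1 := theta1_add_mul_sub ((w₁ - w₂) / 2 + M) ((w₁ - w₂) / 2) hτ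
  have h2 := theta1_add_mul_sub ((w₁ - w₂) / 2 + X) ((w₁ - w₂) / 2) hτ
  have h3 := theta1_add_mul_sub ((w₁ - w₂) / 2 + M) ((w₁ - w₂) / 2 + X) hτ
  have h4 := jacobiTheta₂_add_mul_sub' ((w₁ + w₂) / 2) ((w₁ - w₂) / 2 + X) hτ
  have h5 := jacobiTheta₂_add_mul_sub' ((w₁ + w₂) / 2) ((w₁ - w₂) / 2 + M) hτ
  have h6 := jacobiTheta₂_add_mul_sub' ((w₁ + w₂) / 2) ((w₁ - w₂) / 2) hτ
  rw [show (w₁ - w₂) / 2 + M + (w₁ - w₂) / 2 = w₁ - w₂ + M by ring, add_sub_cancel_left] at h1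
  rw [show (w₁ - w₂) / 2 + X + (w₁ - w₂) / 2 = w₁ - w₂ + X by ring, add_sub_cancel_left] at h2
  rw [show (w₁ - w₂) / 2 + M + ((w₁ - w₂) / 2 + X) = w₁ - w₂ + M + X by ring,
    add_sub_add_left_eq_sub] at h3
  rw [show (w₁ + w₂) / 2 + ((w₁ - w₂) / 2 + X) = w₁ + X by ring,
    show (w₁ + w₂) / 2 - ((w₁ - w₂) / 2 + X) = w₂ - X by ring] at h4
  rw [show (w₁ + w₂) / 2 + ((w₁ - w₂) / 2 + M) = w₁ + M by ring,
    show (w₁ + w₂) / 2 - ((w₁ - w₂) / 2 + M) = w₂ - M by ring] at h5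
  rw [show (w₁ + w₂) / 2 + (w₁ - w₂) / 2 = w₁ by ring,
    show (w₁ + w₂) / 2 - (w₁ - w₂) / 2 = w₂ by ring] at h6
  rw [mul_comm (jacobiTheta₂ (w₂ - X) τ), h1, h2, h3, h4, h5, h6]
  ring

lemma HasSum.congr_of_forall_eq {ι : Type*} {f g : ι → ℂ} {a : ℂ} (hf : HasSum f a)
    (h : ∀ i, g i = f i) : HasSum g a :=
  funext h ▸ hf

lemma hasSum_pow_div_one_sub {q X Y : ℂ} (hq : ‖q‖ ≤ 1) (hX : ‖X‖ < 1) (hY : ‖Y‖ < 1) :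
    HasSum (fun n : ℕ => X ^ n / (1 - q ^ n * Y))
      (∑' p : ℕ × ℕ, X ^ p.1 * Y ^ p.2 * q ^ (p.1 * p.2)) := by
  have hs : Summable (fun p : ℕ × ℕ => X ^ p.1 * Y ^ p.2 * q ^ (p.1 * p.2)) := by
    refine Summable.of_norm_bounded
      ((summable_geometric_of_lt_one (norm_nonneg X) hX).mul_of_nonneg
        (summable_geometric_of_lt_one (norm_nonneg Y) hY) (fun _ => by positivity)
        (fun _ => by positivity)) fun p => ?_
    rw [norm_mul, norm_mul, norm_pow, norm_pow, norm_pow]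
    exact mul_le_of_le_one_right (by positivity) (pow_le_one₀ (norm_nonneg q) hq)
  refine hs.hasSum.prod_fiberwise fun n => ?_
  have hr : ‖q ^ n * Y‖ < 1 := by
    rw [norm_mul, norm_pow]
    exact (mul_le_of_le_one_left (norm_nonneg Y) (pow_le_one₀ (norm_nonneg q) hq)).trans_lt hY
  have h := (hasSum_geometric_of_norm_lt_one hr).mul_left (X ^ n)
  rw [← div_eq_mul_inv] at h
  refine h.congr_of_forall_eq fun m => ?_
  rw [mul_pow, ← pow_mul]
  ring

lemma tsum_pow_mul_pow_comm (q X Y : ℂ) :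
    ∑' p : ℕ × ℕ, X ^ p.1 * Y ^ p.2 * q ^ (p.1 * p.2) =
      ∑' p : ℕ × ℕ, Y ^ p.1 * X ^ p.2 * q ^ (p.1 * p.2) := by
  rw [← (Equiv.prodComm ℕ ℕ).tsum_eq]
  refine tsum_congr fun p => ?_
  simp only [Equiv.prodComm_apply, Prod.fst_swap, Prod.snd_swap]
  ring

/-- Summand of Kronecker's series. -/
noncomputable def kroneckerTerm (τ x y : ℂ) (n : ℤ) : ℂ :=
  exp (2 * Real.pi * I * (n * x)) / (1 - exp (2 * Real.pi * I * (n * τ + y)))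

/-- Kronecker's series `∑ exp(2πinx) / (1 - exp(2πi(nτ + y)))`. -/
noncomputable def kronecker (τ x y : ℂ) : ℂ := ∑' n : ℤ, kroneckerTerm τ x y n

lemma norm_exp_two_pi_I_mul (z : ℂ) :
    ‖exp (2 * Real.pi * I * z)‖ = Real.exp (-(2 * Real.pi * z.im)) := by
  rw [Complex.norm_exp]
  congr 1
  simp [Complex.mul_re, Complex.mul_im]

lemma norm_exp_two_pi_I_mul_lt_one {z : ℂ} (hz : 0 < z.im) :
    ‖exp (2 * Real.pi * I * z)‖ < 1 := by
  rw [norm_exp_two_pi_I_mul, Real.exp_lt_one_iff]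
  have := Real.pi_pos
  have : 0 < 2 * Real.pi * z.im := by positivity
  linarith

lemma hasSum_kroneckerTerm {τ x y : ℂ} (hx : 0 < x.im) (hx' : x.im < τ.im)
    (hy : 0 < y.im) (hy' : y.im < τ.im) :
    HasSum (kroneckerTerm τ x y)
      ((∑' p : ℕ × ℕ, exp (2 * Real.pi * I * x) ^ p.1 * exp (2 * Real.pi * I * y) ^ p.2 *
          exp (2 * Real.pi * I * τ) ^ (p.1 * p.2)) +
        -exp (2 * Real.pi * I * (τ - x - y)) *
        (∑' p : ℕ × ℕ, exp (2 * Real.pi * I * (τ - x)) ^ p.1 *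
          exp (2 * Real.pi * I * (τ - y)) ^ p.2 * exp (2 * Real.pi * I * τ) ^ (p.1 * p.2))) := by
  have hq : ‖exp (2 * Real.pi * I * τ)‖ ≤ 1 := (norm_exp_two_pi_I_mul_lt_one (hx.trans hx')).le
  refine HasSum.of_nat_of_neg_add_one ?_ ?_
  · refine (hasSum_pow_div_one_sub hq (norm_exp_two_pi_I_mul_lt_one hx)
      (norm_exp_two_pi_I_mul_lt_one hy)).congr_of_forall_eq fun n => ?_
    rw [kroneckerTerm, ← Complex.exp_nat_mul, ← Complex.exp_nat_mul, ← Complex.exp_add]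
    congr 2
    · push_cast
      ring
    · congr 1
      push_cast
      ring
  · refine ((hasSum_pow_div_one_sub hq
      (X := exp (2 * Real.pi * I * (τ - x))) (Y := exp (2 * Real.pi * I * (τ - y)))
      (norm_exp_two_pi_I_mul_lt_one (by simpa using hx'))
      (norm_exp_two_pi_I_mul_lt_one (by simpa using hy'))).mul_left
      (-exp (2 * Real.pi * I * (τ - x - y)))).congr_of_forall_eq fun n => ?_
    rw [kroneckerTerm, ← Complex.exp_nat_mul, ← Complex.exp_nat_mul, ← Complex.exp_add]
    have e1 : exp (2 * Real.pi * I * (((-((n : ℤ) + 1) : ℤ) : ℂ) * τ + y)) =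
        (exp (n * (2 * Real.pi * I * τ) + 2 * Real.pi * I * (τ - y)))⁻¹ := by
      rw [← Complex.exp_neg]
      congr 1
      push_cast
      ring
    have e2 : exp (2 * Real.pi * I * (((-((n : ℤ) + 1) : ℤ) : ℂ) * x)) =
        exp (2 * Real.pi * I * (τ - x - y)) * exp (n * (2 * Real.pi * I * (τ - x))) *
          (exp (n * (2 * Real.pi * I * τ) + 2 * Real.pi * I * (τ - y)))⁻¹ := by
      rw [← Complex.exp_neg, ← Complex.exp_add, ← Complex.exp_add]
      congr 1
      push_cast
      ring
    rw [e1, e2]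
    have hne : exp (n * (2 * Real.pi * I * τ) + 2 * Real.pi * I * (τ - y)) ≠ 0 :=
      Complex.exp_ne_zero _
    have hlt : ‖exp (n * (2 * Real.pi * I * τ) + 2 * Real.pi * I * (τ - y))‖ < 1 := by
      rw [show n * (2 * Real.pi * I * τ) + 2 * Real.pi * I * (τ - y) =
        2 * Real.pi * I * (n * τ + (τ - y)) by ring]
      refine norm_exp_two_pi_I_mul_lt_one ?_
      have h1 : (0 : ℝ) ≤ n * τ.im := mul_nonneg n.cast_nonneg (hx.trans hx').le
      simp only [Complex.add_im, Complex.sub_im, Complex.mul_im, Complex.natCast_re,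
        Complex.natCast_im]
      linarith
    generalize exp (n * (2 * Real.pi * I * τ) + 2 * Real.pi * I * (τ - y)) = w at hne hlt
    have hw : 1 - w ≠ 0 := fun h => by
      rw [← sub_eq_zero.mp h] at hlt
      simp at hlt
    have hw' : w - 1 ≠ 0 := fun h => hw (by linear_combination -h)
    have hw'' : 1 - w⁻¹ ≠ 0 := fun h => hw' (by
      have := congrArg (· * w) h
      simpa [sub_mul, hne] using this)
    field_simp
    ring

lemma kronecker_comm {τ x y : ℂ} (hx : 0 < x.im) (hx' : x.im < τ.im)
    (hy : 0 < y.im) (hy' : y.im < τ.im) : kronecker τ x y = kronecker τ y x := by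
  rw [kronecker, kronecker, (hasSum_kroneckerTerm hx hx' hy hy').tsum_eq,
    (hasSum_kroneckerTerm hy hy' hx hx').tsum_eq, tsum_pow_mul_pow_comm,
    tsum_pow_mul_pow_comm _ (exp (2 * Real.pi * I * (τ - x))), sub_right_comm]

lemma theta1_self {τ : ℂ} : theta1 τ τ = 0 := by
  have h : theta1 τ τ = -exp (-(Real.pi * I * τ)) * theta1 0 τ := by
    rw [theta1, theta1, ← (Equiv.addRight (1 : ℤ)).tsum_eq fun n : ℤ =>
      exp (Real.pi * I * ((n : ℂ) + 1/2)^2 * τ + 2 * Real.pi * I * ((n : ℂ) + 1/2) * (0 + 1/2)),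
      ← tsum_mul_left]
    refine tsum_congr fun n => ?_
    rw [Equiv.coe_addRight, ← neg_one_mul, ← Complex.exp_pi_mul_I, ← Complex.exp_add,
      ← Complex.exp_add, ← Complex.exp_periodic]
    congr 1
    push_cast
    ring
  rw [h, theta1_zero, mul_zero]

/-- Coefficient of `exp(2πi(n + 1/2)z)` in `theta1 z τ`. -/
noncomputable def thetaCoeff (τ : ℂ) (n : ℤ) : ℂ :=
  exp (Real.pi * I * ((n : ℂ) + 1 / 2) ^ 2 * τ + Real.pi * I * ((n : ℂ) + 1 / 2))

lemma hasSum_theta1 (z : ℂ) {τ : ℂ} (hτ : 0 < τ.im) :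
    HasSum (fun n => thetaCoeff τ n * exp (2 * Real.pi * I * ((n : ℂ) + 1 / 2) * z))
      (theta1 z τ) := by
  rw [theta1_eq_jacobiTheta₂]
  refine ((hasSum_jacobiTheta₂_term (z + 1 / 2 + τ / 2) hτ).mul_left _).congr_of_forall_eq
    fun n => ?_
  rw [thetaCoeff, jacobiTheta₂_term, ← Complex.exp_add, ← Complex.exp_add]
  congr 1
  ring

lemma summable_norm_thetaCoeff {τ : ℂ} (hτ : 0 < τ.im) :
    Summable (fun n => ‖thetaCoeff τ n‖) := by
  have h := (hasSum_theta1 0 hτ).summable.norm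
  simpa using h

lemma thetaCoeff_add_one (τ : ℂ) (n : ℤ) :
    thetaCoeff τ (n + 1) = -exp (2 * Real.pi * I * (n * τ + τ)) * thetaCoeff τ n := by
  rw [thetaCoeff, thetaCoeff, ← neg_one_mul, ← Complex.exp_pi_mul_I, ← Complex.exp_add,
    ← Complex.exp_add]
  congr 1
  push_cast
  ring

/-- The series `∑ cₘ / (1 - exp(2πi(y - mτ)))`, with `cₘ` the coefficients of `theta1`. -/
noncomputable def appellSum (τ y : ℂ) : ℂ :=
  ∑' m : ℤ, thetaCoeff τ m / (1 - exp (2 * Real.pi * I * (y - m * τ)))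

lemma appellSum_add {τ y : ℂ} (hτ : 0 < τ.im)
    (hy : ∀ m : ℤ, 1 - exp (2 * Real.pi * I * (y - m * τ)) ≠ 0)
    (hs : Summable fun m : ℤ => thetaCoeff τ m / (1 - exp (2 * Real.pi * I * (y - m * τ)))) :
    appellSum τ (y + τ) = -exp (2 * Real.pi * I * (y + τ)) * appellSum τ y := by
  have h0 := (hasSum_theta1 τ hτ).mul_left (-exp (Real.pi * I * τ))
  rw [theta1_self, mul_zero] at h0
  have h1 := h0.add (hs.hasSum.mul_left (-exp (2 * Real.pi * I * (y + τ))))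
  rw [zero_add] at h1
  rw [appellSum, ← (Equiv.addRight (1 : ℤ)).tsum_eq]
  refine (h1.congr_of_forall_eq fun m => ?_).tsum_eq
  have e1 : exp (2 * Real.pi * I * (y + τ - ((m + 1 : ℤ) : ℂ) * τ)) =
      exp (2 * Real.pi * I * (y - m * τ)) := by
    congr 1
    push_cast
    ring
  have e2 : exp (2 * Real.pi * I * (y + τ)) =
      exp (2 * Real.pi * I * (m * τ + τ)) * exp (2 * Real.pi * I * (y - m * τ)) := by
    rw [← Complex.exp_add]
    congr 1
    ring
  have e3 : exp (Real.pi * I * τ) * exp (2 * Real.pi * I * ((m : ℂ) + 1 / 2) * τ) =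
      exp (2 * Real.pi * I * (m * τ + τ)) := by
    rw [← Complex.exp_add]
    congr 1
    ring
  have hm := hy m
  rw [Equiv.coe_addRight, e1, thetaCoeff_add_one, e2]
  rw [← e3]
  generalize exp (Real.pi * I * τ) = A
  generalize exp (2 * Real.pi * I * ((m : ℂ) + 1 / 2) * τ) = B
  generalize exp (2 * Real.pi * I * (y - m * τ)) = C at hm ⊢
  field_simp
  ring

lemma one_sub_exp_ne_zero {τ y : ℂ} (hy : 0 < y.im) (hy' : y.im < τ.im) (m : ℤ) :
    1 - exp (2 * Real.pi * I * (m * τ + y)) ≠ 0 := by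
  intro h
  have h1 := congrArg norm (sub_eq_zero.mp h)
  rw [norm_exp_two_pi_I_mul, norm_one, eq_comm, Real.exp_eq_one_iff, neg_eq_zero, mul_eq_zero,
    or_iff_right (by positivity)] at h1
  have h2 : (m : ℝ) * τ.im + y.im = 0 := by simpa using h1
  rcases le_or_gt 0 m with hm | hm
  · have : (0 : ℝ) ≤ m * τ.im := mul_nonneg (by exact_mod_cast hm) (hy.trans hy').le
    linarith
  · have : (m : ℝ) ≤ -1 := by exact_mod_cast Int.le_sub_one_of_lt hm
    nlinarith

lemma hasSum_theta1_mul_kronecker {τ x y : ℂ} (hx : 0 < x.im) (hx' : x.im < τ.im)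
    (hy : 0 < y.im) (hy' : y.im < τ.im) :
    HasSum (fun p : ℤ × ℤ => exp (2 * Real.pi * I * ((p.1 : ℂ) + 1 / 2) * x) *
        (thetaCoeff τ p.2 / (1 - exp (2 * Real.pi * I * (y + p.1 * τ - p.2 * τ)))))
      (theta1 x τ * kronecker τ x y) := by
  have hK : HasSum (kroneckerTerm τ x y) (kronecker τ x y) :=
    (hasSum_kroneckerTerm hx hx' hy hy').summable.hasSum
  have h := HasSum.mul_of_complex (hasSum_theta1 x (hx.trans hx')) hK
  let e : ℤ × ℤ ≃ ℤ × ℤ :=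
    { toFun := fun p => (p.2, p.1 - p.2)
      invFun := fun p => (p.1 + p.2, p.1)
      left_inv := fun p => by simp
      right_inv := fun p => by simp }
  refine (e.hasSum_iff.mpr h).congr_of_forall_eq fun p => ?_
  simp only [e, Function.comp_apply, Equiv.coe_fn_mk, kroneckerTerm]
  have e1 : exp (2 * Real.pi * I * ((p.1 : ℂ) + 1 / 2) * x) =
      exp (2 * Real.pi * I * ((p.2 : ℂ) + 1 / 2) * x) *
        exp (2 * Real.pi * I * (((p.1 - p.2 : ℤ) : ℂ) * x)) := by
    rw [← Complex.exp_add]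
    congr 1
    push_cast
    ring
  have e2 : y + p.1 * τ - p.2 * τ = ((p.1 - p.2 : ℤ) : ℂ) * τ + y := by
    push_cast
    ring
  rw [e1, e2]
  ring

lemma summable_appellSum {τ y : ℂ} (hy : 0 < y.im) (hy' : y.im < τ.im) (n : ℤ) :
    Summable fun m : ℤ =>
      thetaCoeff τ m / (1 - exp (2 * Real.pi * I * (y + n * τ - m * τ))) := by
  have h : Summable fun m : ℤ => exp (2 * Real.pi * I * ((n : ℂ) + 1 / 2) * y) *
      (thetaCoeff τ m / (1 - exp (2 * Real.pi * I * (y + n * τ - m * τ)))) :=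
    (hasSum_theta1_mul_kronecker hy hy' hy hy').summable.prod_factor n
  exact (summable_mul_left_iff (Complex.exp_ne_zero _)).mp h

/-- The quotient of `theta1 x τ * kronecker τ x y` by `theta1 (x + y) τ`. -/
noncomputable def kroneckerFactor (τ y : ℂ) : ℂ :=
  appellSum τ y * exp (-(Real.pi * I * τ / 4 + Real.pi * I / 2 + Real.pi * I * y))

lemma appellSum_add_int_mul {τ y : ℂ} (hy : 0 < y.im) (hy' : y.im < τ.im) (n : ℤ) :
    appellSum τ (y + n * τ) = thetaCoeff τ n * exp (2 * Real.pi * I * ((n : ℂ) + 1 / 2) * y) *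
      kroneckerFactor τ y := by
  have step (n : ℤ) : appellSum τ (y + (n + 1 : ℤ) * τ) =
      -exp (2 * Real.pi * I * (y + n * τ + τ)) * appellSum τ (y + n * τ) := by
    rw [← appellSum_add (hy.trans hy') (fun m => ?_) (summable_appellSum hy hy' n)]
    · congr 1
      push_cast
      ring
    · convert one_sub_exp_ne_zero hy hy' (n - m) using 4
      push_cast
      ring
  have hexp (n : ℤ) : -exp (2 * Real.pi * I * (y + n * τ + τ)) *
      (thetaCoeff τ n * exp (2 * Real.pi * I * ((n : ℂ) + 1 / 2) * y)) =
      thetaCoeff τ (n + 1) * exp (2 * Real.pi * I * (((n + 1 : ℤ) : ℂ) + 1 / 2) * y) := by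
    have h : exp (2 * Real.pi * I * (y + n * τ + τ)) *
        exp (2 * Real.pi * I * ((n : ℂ) + 1 / 2) * y) = exp (2 * Real.pi * I * (n * τ + τ)) *
        exp (2 * Real.pi * I * (((n + 1 : ℤ) : ℂ) + 1 / 2) * y) := by
      rw [← Complex.exp_add, ← Complex.exp_add]
      congr 1
      push_cast
      ring
    rw [thetaCoeff_add_one]
    linear_combination (-thetaCoeff τ n) * h
  induction n using Int.induction_on with
  | zero =>
    rw [kroneckerFactor, thetaCoeff, mul_left_comm, ← Complex.exp_add, ← Complex.exp_add,
      Int.cast_zero, zero_mul, add_zero]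
    ring_nf
    simp
  | succ n ih => rw [step, ih, ← mul_assoc, hexp]
  | pred n ih =>
    have h := step (-n - 1)
    have h2 := hexp (-n - 1)
    rw [sub_add_cancel] at h h2
    rw [ih, ← h2, mul_assoc] at h
    exact (mul_left_cancel₀ (neg_ne_zero.mpr (Complex.exp_ne_zero _)) h).symm

lemma theta1_mul_kronecker {τ x y : ℂ} (hx : 0 < x.im) (hx' : x.im < τ.im)
    (hy : 0 < y.im) (hy' : y.im < τ.im) :
    theta1 x τ * kronecker τ x y = theta1 (x + y) τ * kroneckerFactor τ y := by
  have h : HasSum (fun n : ℤ => exp (2 * Real.pi * I * ((n : ℂ) + 1 / 2) * x) *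
      appellSum τ (y + n * τ)) (theta1 x τ * kronecker τ x y) :=
    (hasSum_theta1_mul_kronecker hx hx' hy hy').prod_fiberwise fun n =>
      (summable_appellSum hy hy' n).hasSum.mul_left
        (exp (2 * Real.pi * I * ((n : ℂ) + 1 / 2) * x))
  refine h.unique (((hasSum_theta1 (x + y) (hx.trans hx')).mul_right
    (kroneckerFactor τ y)).congr_of_forall_eq fun n => ?_)
  rw [appellSum_add_int_mul hy hy', ← mul_assoc, mul_left_comm, ← Complex.exp_add]
  congr 3
  ring

open Filter Topology in
lemma tendsto_theta1_mul_kroneckerFactor {τ : ℂ} (hτ : 0 < τ.im) :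
    Tendsto (fun t : ℝ => theta1 (t * I) τ * kroneckerFactor τ (t * I)) (𝓝[>] 0)
      (𝓝 (-theta1'0 τ / (2 * Real.pi * I))) := by
  have hpi := Real.pi_pos
  have h2πI : (2 * Real.pi * I : ℂ) ≠ 0 := Complex.two_pi_I_ne_zero
  have hcont {g : ℂ → ℂ} (hg : Continuous g) :
      Tendsto (fun t : ℝ => g (t * I)) (𝓝[>] 0) (𝓝 (g 0)) := by
    have h : Continuous fun t : ℝ => g (t * I) := by fun_prop
    simpa using (h.tendsto 0).mono_left nhdsWithin_le_nhds
  have hpos : ∀ᶠ t : ℝ in 𝓝[>] 0, 0 < t := self_mem_nhdsWithin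
  have hsmall : ∀ᶠ t : ℝ in 𝓝[>] 0, t < τ.im / 2 :=
    nhdsWithin_le_nhds (Iio_mem_nhds (by positivity))
  have hpunct : Tendsto (fun t : ℝ => (t * I : ℂ)) (𝓝[>] 0) (𝓝[≠] 0) := by
    refine tendsto_nhdsWithin_iff.mpr ⟨hcont continuous_id, hpos.mono fun t ht => ?_⟩
    simpa using ht.ne'
  have hθ : Tendsto (fun t : ℝ => theta1 (t * I) τ / (t * I)) (𝓝[>] 0) (𝓝 (theta1'0 τ)) := by
    have h := ((differentiable_theta1 hτ 0).hasDerivAt.tendsto_slope).comp hpunct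
    refine h.congr fun t => ?_
    simp [slope_def_field, theta1_zero]
  have hE : Tendsto (fun t : ℝ => (1 - exp (2 * Real.pi * I * (t * I))) / (t * I)) (𝓝[>] 0)
      (𝓝 (-(2 * Real.pi * I))) := by
    have hd : HasDerivAt (fun z : ℂ => 1 - exp (2 * Real.pi * I * z)) (-(2 * Real.pi * I)) 0 := by
      have := (((hasDerivAt_id (0 : ℂ)).const_mul (2 * Real.pi * I)).cexp).const_sub 1
      simpa using this
    refine (hd.tendsto_slope.comp hpunct).congr fun t => ?_
    simp [slope_def_field]
  have hY {t : ℝ} (ht : 0 < t) : ‖exp (2 * Real.pi * I * (t * I))‖ < 1 :=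
    norm_exp_two_pi_I_mul_lt_one (by simpa using ht)
  have hA : Tendsto (fun t : ℝ => ∑' m : ℤ, (1 - exp (2 * Real.pi * I * (t * I))) *
      (thetaCoeff τ m / (1 - exp (2 * Real.pi * I * (t * I - m * τ))))) (𝓝[>] 0)
      (𝓝 (∑' m : ℤ, if m = 0 then thetaCoeff τ 0 else 0)) := by
    have hr : 0 < 1 - Real.exp (-(2 * Real.pi * τ.im)) := by
      rw [sub_pos, Real.exp_lt_one_iff]
      have : 0 < 2 * Real.pi * τ.im := by positivity
      linarith
    have hr' : 0 < Real.exp (Real.pi * τ.im) - 1 := by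
      rw [sub_pos, Real.one_lt_exp_iff]
      positivity
    refine tendsto_tsum_of_dominated_convergence
      (bound := fun m => ‖thetaCoeff τ m‖ * (1 + 2 / (1 - Real.exp (-(2 * Real.pi * τ.im))) +
        2 / (Real.exp (Real.pi * τ.im) - 1)))
      ((summable_norm_thetaCoeff hτ).mul_right _) (fun m => ?_) ?_
    · split_ifs with hm
      · subst hm
        refine tendsto_const_nhds.congr' (hpos.mono fun t ht => ?_)
        have h1 : 1 - exp (2 * Real.pi * I * (t * I)) ≠ 0 := fun h => by
          have := hY ht
          rw [← sub_eq_zero.mp h] at this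
          simp at this
        simp only [Int.cast_zero, zero_mul, sub_zero]
        exact (mul_div_cancel₀ _ h1).symm
      · have hne : 1 - exp (2 * Real.pi * I * (0 - m * τ)) ≠ 0 := by
          intro h
          have h1 := congrArg norm (sub_eq_zero.mp h)
          rw [norm_exp_two_pi_I_mul, norm_one, eq_comm, Real.exp_eq_one_iff, neg_eq_zero,
            mul_eq_zero, or_iff_right (by positivity)] at h1
          have h2 : m = 0 ∨ τ.im = 0 := by simpa using h1
          exact h2.elim hm hτ.ne'
        have h1 := hcont (g := fun z => 1 - exp (2 * Real.pi * I * z)) (by fun_prop)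
        have h2 := hcont (g := fun z => 1 - exp (2 * Real.pi * I * (z - m * τ))) (by fun_prop)
        have h3 := h1.mul ((tendsto_const_nhds (x := thetaCoeff τ m)).div h2 hne)
        simpa using h3
    · filter_upwards [hpos, hsmall] with t ht ht' m
      rw [norm_mul, norm_div, mul_div_left_comm]
      refine mul_le_mul_of_nonneg_left ?_ (norm_nonneg _)
      have hnum : ‖1 - exp (2 * Real.pi * I * (t * I))‖ ≤ 2 := by
        refine (norm_sub_le _ _).trans ?_
        rw [norm_one]
        linarith [hY ht]
      have hnorm : ‖exp (2 * Real.pi * I * (t * I - m * τ))‖ =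
          Real.exp (-(2 * Real.pi * (t - m * τ.im))) := by
        rw [norm_exp_two_pi_I_mul]
        simp
      have p1 : 0 ≤ 2 / (1 - Real.exp (-(2 * Real.pi * τ.im))) := by positivity
      have p2 : 0 ≤ 2 / (Real.exp (Real.pi * τ.im) - 1) := by positivity
      rcases lt_trichotomy m 0 with hm | rfl | hm
      · have hle : 1 - Real.exp (-(2 * Real.pi * τ.im)) ≤
            ‖1 - exp (2 * Real.pi * I * (t * I - m * τ))‖ := by
          refine le_trans ?_ (norm_sub_norm_le _ _)
          rw [norm_one, hnorm]
          gcongr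
          have : (m : ℝ) ≤ -1 := by exact_mod_cast Int.le_sub_one_of_lt hm
          nlinarith
        have := div_le_div₀ zero_le_two hnum hr hle
        linarith
      · have : ‖1 - exp (2 * Real.pi * I * (t * I))‖ /
            ‖1 - exp (2 * Real.pi * I * (t * I - (0 : ℤ) * τ))‖ ≤ 1 := by
          rw [Int.cast_zero, zero_mul, sub_zero]
          exact div_self_le_one _
        linarith
      · have hle : Real.exp (Real.pi * τ.im) - 1 ≤
            ‖1 - exp (2 * Real.pi * I * (t * I - m * τ))‖ := by
          rw [norm_sub_rev]
          refine le_trans ?_ (norm_sub_norm_le _ _)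
          rw [norm_one, hnorm]
          gcongr
          have : (1 : ℝ) ≤ m := by exact_mod_cast hm
          have : τ.im / 2 ≤ m * τ.im - t := by nlinarith
          nlinarith
        have := div_le_div₀ zero_le_two hnum hr' hle
        linarith
  rw [tsum_ite_eq] at hA
  have hexp := hcont
    (g := fun z => exp (-(Real.pi * I * τ / 4 + Real.pi * I / 2 + Real.pi * I * z))) (by fun_prop)
  have hlim := ((hθ.div hE (neg_ne_zero.mpr h2πI)).mul hA).mul hexp
  have hval : theta1'0 τ / -(2 * Real.pi * I) * thetaCoeff τ 0 *
      exp (-(Real.pi * I * τ / 4 + Real.pi * I / 2 + Real.pi * I * 0)) =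
      -theta1'0 τ / (2 * Real.pi * I) := by
    rw [thetaCoeff, mul_assoc, ← Complex.exp_add, div_neg, neg_div, Int.cast_zero]
    ring_nf
    simp
  rw [hval] at hlim
  refine hlim.congr' (hpos.mono fun t ht => ?_)
  have h1 : 1 - exp (2 * Real.pi * I * (t * I)) ≠ 0 := fun h => by
    have := hY ht
    rw [← sub_eq_zero.mp h] at this
    simp at this
  have h2 : (t * I : ℂ) ≠ 0 := by simpa using ht.ne'
  simp only [Pi.div_apply, kroneckerFactor, appellSum, tsum_mul_left]
  generalize 1 - exp (2 * Real.pi * I * (t * I)) = w at h1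
  generalize ∑' m : ℤ, thetaCoeff τ m / (1 - exp (2 * Real.pi * I * (t * I - m * τ))) = A
  generalize theta1 (t * I) τ = B
  generalize (t * I : ℂ) = z at h2 ⊢
  field_simp

lemma theta1_mul_kroneckerFactor {τ x : ℂ} (hx : 0 < x.im) (hx' : x.im < τ.im)
    (hθ : theta1 x τ ≠ 0) :
    theta1 x τ * kroneckerFactor τ x = -theta1'0 τ / (2 * Real.pi * I) := by
  have hτ := hx.trans hx'
  have hpos : ∀ᶠ t : ℝ in nhdsWithin 0 (Set.Ioi 0), 0 < t := self_mem_nhdsWithin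
  have hsmall : ∀ᶠ t : ℝ in nhdsWithin 0 (Set.Ioi 0), t < τ.im :=
    nhdsWithin_le_nhds (Iio_mem_nhds hτ)
  have hc : Filter.Tendsto (fun t : ℝ => theta1 (x + t * I) τ) (nhdsWithin 0 (Set.Ioi 0))
      (nhds (theta1 x τ)) := by
    have h : Continuous fun t : ℝ => theta1 (x + t * I) τ :=
      (differentiable_theta1 hτ).continuous.comp (by fun_prop)
    simpa using (h.tendsto 0).mono_left nhdsWithin_le_nhds
  have h1 := hc.mul (tendsto_theta1_mul_kroneckerFactor hτ)
  have h2 := hc.mul_const (theta1 x τ * kroneckerFactor τ x)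
  have h3 := tendsto_nhds_unique_of_eventuallyEq h1 h2 ?_
  · exact (mul_left_cancel₀ hθ h3).symm
  filter_upwards [hpos, hsmall] with t ht ht'
  have hy : 0 < ((t : ℂ) * I).im := by simpa using ht
  have hy' : ((t : ℂ) * I).im < τ.im := by simpa using ht'
  have e1 := theta1_mul_kronecker hx hx' hy hy'
  have e2 := theta1_mul_kronecker hy hy' hx hx'
  rw [kronecker_comm hy hy' hx hx', add_comm] at e2
  linear_combination theta1 x τ * e2 - theta1 (t * I) τ * e1

/-- Kronecker's formula. -/
lemma theta1_mul_theta1_mul_kronecker {τ x y : ℂ} (hx : 0 < x.im) (hx' : x.im < τ.im)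
    (hy : 0 < y.im) (hy' : y.im < τ.im) (hθ : theta1 y τ ≠ 0) :
    theta1 x τ * theta1 y τ * kronecker τ x y =
      -theta1'0 τ / (2 * Real.pi * I) * theta1 (x + y) τ := by
  rw [← theta1_mul_kroneckerFactor hy hy' hθ]
  linear_combination theta1 y τ * theta1_mul_kronecker hx hx' hy hy'

lemma sum_inv_one_sub_mul_stdAddChar (k : ℕ) [NeZero k] {V : ℂ} (hV : 1 - V ^ k ≠ 0) :
    ∑ c : ZMod k, (1 - V * ZMod.stdAddChar c)⁻¹ = k / (1 - V ^ k) := by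
  have hpow (c : ZMod k) : (ZMod.stdAddChar c : ℂ) ^ k = 1 := by
    rw [← AddChar.map_nsmul_eq_pow, nsmul_eq_mul, CharP.cast_eq_zero, zero_mul,
      AddChar.map_zero_eq_one]
  have hterm (c : ZMod k) : (1 - V * ZMod.stdAddChar c)⁻¹ =
      (∑ j ∈ Finset.range k, V ^ j * ZMod.stdAddChar (c * (j : ZMod k))) / (1 - V ^ k) := by
    have hg := geom_sum_mul_neg (V * ZMod.stdAddChar c) k
    rw [mul_pow, hpow, mul_one] at hg
    have hne : 1 - V * ZMod.stdAddChar c ≠ 0 := fun h => hV (by rw [← hg, h, mul_zero])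
    rw [inv_eq_one_div, div_eq_div_iff hne hV, one_mul, ← hg]
    congr 1
    refine Finset.sum_congr rfl fun j _ => ?_
    rw [mul_pow, ← AddChar.map_nsmul_eq_pow, nsmul_eq_mul, mul_comm c]
  simp_rw [hterm]
  rw [← Finset.sum_div, Finset.sum_comm]
  congr 1
  rw [Finset.sum_eq_single_of_mem 0 (Finset.mem_range.mpr (NeZero.pos k))]
  · simp
  · intro j hj hj0
    have hj1 : (j : ZMod k) ≠ 0 := by
      rw [Ne, ZMod.natCast_eq_zero_iff]
      exact Nat.not_dvd_of_pos_of_lt (Nat.pos_of_ne_zero hj0) (Finset.mem_range.mp hj)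
    rw [← Finset.mul_sum, AddChar.sum_mulShift _ (ZMod.isPrimitive_stdAddChar k), if_neg hj1]
    simp

lemma kronecker_eq_sum {τ x y : ℂ} {k : ℕ} [NeZero k] (a : ZMod k)
    (hx : 0 < x.im) (hx' : x.im < (τ / k).im) (hy : 0 < y.im) (hy' : y.im < τ.im) :
    k * kronecker τ x y =
      ∑ c : ZMod k, kronecker (τ / k) x ((y + (a.val : ℂ) - (c.val : ℂ)) / k) := by
  have hk : (k : ℂ) ≠ 0 := NeZero.ne _
  have hk0 : (0 : ℝ) < k := by exact_mod_cast NeZero.pos k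
  have him (z : ℂ) : (z / k).im = z.im / k := by
    rw [← Complex.ofReal_natCast, Complex.div_ofReal_im]
  have hs (c : ZMod k) :
      Summable (kroneckerTerm (τ / k) x ((y + (a.val : ℂ) - (c.val : ℂ)) / k)) := by
    refine (hasSum_kroneckerTerm hx hx' ?_ ?_).summable
    · rw [him]
      simpa [-ZMod.natCast_val] using div_pos hy hk0
    · rw [him, him]
      simpa [-ZMod.natCast_val] using div_lt_div_of_pos_right hy' hk0
  simp only [kronecker]
  rw [← Summable.tsum_finsetSum fun c _ => hs c, ← tsum_mul_left]
  refine tsum_congr fun n => ?_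
  have hV : exp (2 * Real.pi * I * (n * τ + y)) =
      exp (2 * Real.pi * I * (n * (τ / k) + y / k)) ^ k := by
    rw [← Complex.exp_nat_mul]
    congr 1
    field_simp
  have hterm (c : ZMod k) :
      kroneckerTerm (τ / k) x ((y + (a.val : ℂ) - (c.val : ℂ)) / k) n =
        exp (2 * Real.pi * I * (n * x)) *
          (1 - exp (2 * Real.pi * I * (n * (τ / k) + y / k)) * ZMod.stdAddChar (a - c))⁻¹ := by
    have hac : a - c = (((a.val : ℤ) - (c.val : ℤ) : ℤ) : ZMod k) := by
      push_cast
      rw [ZMod.natCast_zmod_val, ZMod.natCast_zmod_val]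
    rw [hac, ZMod.stdAddChar_coe, kroneckerTerm, div_eq_mul_inv, ← Complex.exp_add]
    congr 4
    push_cast
    ring
  have hne := one_sub_exp_ne_zero hy hy' n
  rw [hV] at hne
  have hsum := ((Equiv.subLeft a).sum_comp fun c => (1 -
    exp (2 * Real.pi * I * (n * (τ / k) + y / k)) * ZMod.stdAddChar c)⁻¹).trans
      (sum_inv_one_sub_mul_stdAddChar k hne)
  simp only [Equiv.subLeft_apply] at hsum
  rw [Finset.sum_congr rfl fun c _ => hterm c, ← Finset.mul_sum, hsum, kroneckerTerm, hV]
  ring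

lemma Differentiable.eq_of_eq_on_strip {f g : ℂ → ℂ} (hf : Differentiable ℂ f)
    (hg : Differentiable ℂ g) {r : ℝ} (hr : 0 < r)
    (h : ∀ z : ℂ, 0 < z.im → z.im < r → f z = g z) : f = g := by
  have hf' : AnalyticOnNhd ℂ f Set.univ := fun z _ => hf.analyticAt z
  have hg' : AnalyticOnNhd ℂ g Set.univ := fun z _ => hg.analyticAt z
  refine hf'.eq_of_eventuallyEq (z₀ := (r / 2 : ℝ) * I) hg' ?_
  have h0 : 0 < (((r / 2 : ℝ) : ℂ) * I).im := by simpa using hr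
  have hr' : (((r / 2 : ℝ) : ℂ) * I).im < r := by simpa using hr
  filter_upwards [Complex.continuous_im.continuousAt.eventually (lt_mem_nhds h0),
    Complex.continuous_im.continuousAt.eventually (gt_mem_nhds hr')] with z h1 h2
  exact h z h1 h2

lemma theta1_average_of_strip {τ u y : ℂ} {k : ℕ} [NeZero k] (a : ZMod k)
    (hu : 0 < u.im) (hu' : u.im < (τ / k).im) (hy : 0 < y.im) (hy' : y.im < τ.im)
    (hθ : theta1 y τ ≠ 0)
    (hθ' : ∀ c : ZMod k, theta1 ((y + (a.val : ℂ) - (c.val : ℂ)) / k) (τ / k) ≠ 0) :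
    k * theta1 (u + y) τ * theta1'0 τ * theta1 u (τ / k) =
      theta1 u τ * theta1 y τ * theta1'0 (τ / k) *
        ∑ c : ZMod k, theta1 (u + (y + (a.val : ℂ) - (c.val : ℂ)) / k) (τ / k) /
          theta1 ((y + (a.val : ℂ) - (c.val : ℂ)) / k) (τ / k) := by
  have hk0 : (0 : ℝ) < k := by exact_mod_cast NeZero.pos k
  have hk1 : (1 : ℝ) ≤ k := by exact_mod_cast NeZero.one_le
  have him (z : ℂ) : (z / k).im = z.im / k := by
    rw [← Complex.ofReal_natCast, Complex.div_ofReal_im]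
  have hτ := hy.trans hy'
  have hu'' : u.im < τ.im := by
    rw [him] at hu'
    exact hu'.trans_le (div_le_self hτ.le hk1)
  have hc (c : ZMod k) :
      theta1 u (τ / k) * kronecker (τ / k) u ((y + (a.val : ℂ) - (c.val : ℂ)) / k) =
        -theta1'0 (τ / k) / (2 * Real.pi * I) *
          (theta1 (u + (y + (a.val : ℂ) - (c.val : ℂ)) / k) (τ / k) /
            theta1 ((y + (a.val : ℂ) - (c.val : ℂ)) / k) (τ / k)) := by
    rw [mul_div_assoc', eq_div_iff (hθ' c), ← theta1_mul_theta1_mul_kronecker hu hu' ?_ ?_ (hθ' c)]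
    · ring
    · rw [him]
      simpa [-ZMod.natCast_val] using div_pos hy hk0
    · rw [him, him]
      simpa [-ZMod.natCast_val] using div_lt_div_of_pos_right hy' hk0
  have h1 := theta1_mul_theta1_mul_kronecker hu hu'' hy hy' hθ
  have h2 := congrArg (theta1 u (τ / k) * ·) (kronecker_eq_sum a hu hu' hy hy')
  simp only [Finset.mul_sum, hc] at h2
  rw [← Finset.mul_sum] at h2
  have hpi := Complex.two_pi_I_ne_zero
  rw [div_mul_eq_mul_div, eq_div_iff hpi] at h1 h2
  linear_combination (k : ℂ) * theta1 u (τ / k) * h1 - theta1 u τ * theta1 y τ * h2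

lemma theta1_average {τ : ℂ} (hτ : 0 < τ.im) {k : ℕ} [NeZero k] (a : ZMod k) (u y : ℂ)
    (hθ : theta1 y τ ≠ 0)
    (hθ' : ∀ c : ZMod k, theta1 ((y + (a.val : ℂ) - (c.val : ℂ)) / k) (τ / k) ≠ 0) :
    k * theta1 (u + y) τ * theta1'0 τ * theta1 u (τ / k) =
      theta1 u τ * theta1 y τ * theta1'0 (τ / k) *
        ∑ c : ZMod k, theta1 (u + (y + (a.val : ℂ) - (c.val : ℂ)) / k) (τ / k) /
          theta1 ((y + (a.val : ℂ) - (c.val : ℂ)) / k) (τ / k) := by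
  have hk0 : (0 : ℝ) < k := by exact_mod_cast NeZero.pos k
  have hτk : 0 < (τ / k).im := by
    rw [← Complex.ofReal_natCast, Complex.div_ofReal_im]
    positivity
  have hstrip (u y : ℂ) (hu : 0 < u.im) (hu' : u.im < (τ / k).im) (hy : 0 < y.im)
    (hy' : y.im < τ.im) := theta1_average_of_strip (u := u) (y := y) a hu hu' hy hy'
  obtain ⟨f, hf, hfθ⟩ : ∃ f : ℂ → ℂ, Differentiable ℂ f ∧ ∀ z, theta1 z τ = f z :=
    ⟨_, differentiable_theta1 hτ, fun _ => rfl⟩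
  obtain ⟨g, hg, hgθ⟩ : ∃ g : ℂ → ℂ, Differentiable ℂ g ∧ ∀ z, theta1 z (τ / k) = g z :=
    ⟨_, differentiable_theta1 hτk, fun _ => rfl⟩
  simp only [hfθ, hgθ] at *
  have hu (u y : ℂ) (hy : 0 < y.im) (hy' : y.im < τ.im) (hθ : f y ≠ 0)
      (hθ' : ∀ c : ZMod k, g ((y + (a.val : ℂ) - (c.val : ℂ)) / k) ≠ 0) :=
    congrFun (Differentiable.eq_of_eq_on_strip
      (f := fun u => k * f (u + y) * theta1'0 τ * g u)
      (g := fun u => f u * f y * theta1'0 (τ / k) *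
        ∑ c : ZMod k, g (u + (y + (a.val : ℂ) - (c.val : ℂ)) / k) /
          g ((y + (a.val : ℂ) - (c.val : ℂ)) / k))
      (by fun_prop) (by fun_prop) hτk
      (fun u h h' => hstrip u y h h' hy hy' hθ hθ')) u
  let P : ℂ → ℂ := fun y => ∏ c : ZMod k, g ((y + (a.val : ℂ) - (c.val : ℂ)) / k)
  let S : ℂ → ℂ := fun y => ∑ c : ZMod k, g (u + (y + (a.val : ℂ) - (c.val : ℂ)) / k) *
    ∏ c' ∈ Finset.univ.erase c, g ((y + (a.val : ℂ) - (c'.val : ℂ)) / k)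
  have hP : Differentiable ℂ P := by fun_prop
  have hS : Differentiable ℂ S := by fun_prop
  have hPS (y : ℂ) (hy : ∀ c : ZMod k, g ((y + (a.val : ℂ) - (c.val : ℂ)) / k) ≠ 0) :
      P y * ∑ c : ZMod k, g (u + (y + (a.val : ℂ) - (c.val : ℂ)) / k) /
          g ((y + (a.val : ℂ) - (c.val : ℂ)) / k) = S y := by
    rw [Finset.mul_sum]
    refine Finset.sum_congr rfl fun c _ => ?_
    rw [mul_div_assoc', div_eq_iff (hy c), mul_comm (P y), mul_assoc,
      Finset.prod_erase_mul _ _ (Finset.mem_univ c)]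
  have hy := congrFun (Differentiable.eq_of_eq_on_strip
    (f := fun y => f y * P y * (k * f (u + y) * theta1'0 τ * g u * P y))
    (g := fun y => f y * P y * (f u * f y * theta1'0 (τ / k) * S y))
    (by fun_prop) (by fun_prop) hτ fun y h h' => ?_) y
  · have hP0 : P y ≠ 0 := Finset.prod_ne_zero_iff.mpr fun c _ => hθ' c
    have h := mul_left_cancel₀ (mul_ne_zero hθ hP0) hy
    rw [← hPS y hθ'] at h
    refine mul_right_cancel₀ hP0 ?_
    linear_combination h
  · by_cases h0 : f y * P y = 0
    · rw [h0, zero_mul, zero_mul]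
    · have h1 : ∀ c : ZMod k, g ((y + (a.val : ℂ) - (c.val : ℂ)) / k) ≠ 0 := fun c =>
        Finset.prod_ne_zero_iff.mp (right_ne_zero_of_mul h0) c (Finset.mem_univ c)
      rw [hu u y h h' (left_ne_zero_of_mul h0) h1, ← hPS y h1]
      ring

lemma thetaA_eq_jacobiTheta₂_val (τ : ℂ) (k : ℕ) [NeZero k] (a : ZMod k) (z : ℂ) :
    thetaA τ k a z = jacobiTheta₂ (z - (a.val : ℂ) / k) (τ / k) := by
  simpa [-ZMod.natCast_val, ZMod.natCast_zmod_val] using thetaA_eq_jacobiTheta₂ τ k a.val z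

lemma continuous_thetaA {τ : ℂ} (k : ℕ) [NeZero k] (hτ : 0 < (τ / k).im) (a : ZMod k) :
    Continuous (thetaA τ k a) := by
  rw [funext (thetaA_eq_jacobiTheta₂_val τ k a)]
  have h : Differentiable ℂ fun z => jacobiTheta₂ z (τ / k) := fun z =>
    differentiableAt_jacobiTheta₂_fst z hτ
  exact h.continuous.comp (by fun_prop : Continuous fun z : ℂ => z - (a.val : ℂ) / k)

/-- The averaging identity `σ_μ(z,τ) = (1/k) ∑ σ_{(μ-a+c)/k}(z,τ/k)`, with denominators in `z` for
the modulus `τ/k` cleared. -/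
lemma sigmaE_average {τ : ℂ} (hτ : 0 < τ.im) {k : ℕ} [NeZero k] {μ u : ℂ} (a : ZMod k)
    (hgen : ∀ c : ZMod k, theta1 ((μ - (a.val : ℂ) + (c.val : ℂ)) / k) (τ / k) ≠ 0)
    (hμ : theta1 (-μ) τ ≠ 0) (hu : theta1 u τ ≠ 0) :
    k * theta1 u (τ / k) * sigmaE τ μ u = -theta1'0 (τ / k) *
      ∑ c : ZMod k, theta1 (u - (μ - (a.val : ℂ) + (c.val : ℂ)) / k) (τ / k) /
        theta1 ((μ - (a.val : ℂ) + (c.val : ℂ)) / k) (τ / k) := by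
  have harg (c : ZMod k) : (-μ + (a.val : ℂ) - (c.val : ℂ)) / k =
      -((μ - (a.val : ℂ) + (c.val : ℂ)) / k) := by ring
  have h := theta1_average hτ a u (-μ) hμ fun c => by
    rw [harg, theta1_neg]
    exact neg_ne_zero.mpr (hgen c)
  simp only [harg, theta1_neg _ (τ / k), div_neg, Finset.sum_neg_distrib, ← sub_eq_add_neg] at h
  rw [sigmaE, mul_div_assoc', div_eq_iff (mul_ne_zero hu hμ)]
  linear_combination h

lemma belavin_matrix_elements_of_ne_zero {τ : ℂ} (hτ : 0 < τ.im) {k : ℕ} [NeZero k]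
    {μ ξ : ℂ} (a b : ZMod k)
    (hgenμ : ∀ c : ZMod k, theta1 ((μ - (a.val : ℂ) + (c.val : ℂ)) / k) (τ / k) ≠ 0)
    (hgenξ : ∀ c : ZMod k, theta1 ((ξ - (b.val : ℂ) + (c.val : ℂ)) / k) (τ / k) ≠ 0)
    (hμ0 : theta1 (-μ) τ ≠ 0) (hξ0 : theta1 (-ξ) τ ≠ 0)
    {z1 z2 : ℂ} (hz : theta1 (z1 - z2 + (μ + ξ) / k) τ ≠ 0)
    (hz' : theta1 (z1 - z2 + (μ + ξ) / k) (τ / k) ≠ 0) :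
    sigmaE τ μ (z1 - z2 + (μ + ξ) / k) *
        thetaA τ k a (z1 + μ / k) * thetaA τ k b (z2 - μ / k) -
      sigmaE τ ξ (z1 - z2 + (μ + ξ) / k) *
        thetaA τ k a (z2 - ξ / k) * thetaA τ k b (z1 + ξ / k) =
    ∑ c : ZMod k, ∑ d : ZMod k,
      belavinR τ k μ ξ a b c d * thetaA τ k c z1 * thetaA τ k d z2 := by
  have hk : (k : ℂ) ≠ 0 := NeZero.ne _
  have hk0 : (0 : ℝ) < k := by exact_mod_cast NeZero.pos k
  have hτk : 0 < (τ / k).im := by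
    rw [← Complex.ofReal_natCast, Complex.div_ofReal_im]
    positivity
  have hd (c : ZMod k) (z : ℂ) : thetaA τ k (a + b - c) z =
      jacobiTheta₂ (z - ((a.val : ℂ) + b.val - c.val) / k) (τ / k) := by
    have h := thetaA_eq_jacobiTheta₂ τ k ((a.val : ℤ) + b.val - c.val) z
    push_cast at h
    simpa only [ZMod.natCast_zmod_val] using h
  have hsum (c : ZMod k) :
      ∑ d : ZMod k, belavinR τ k μ ξ a b c d * thetaA τ k c z1 * thetaA τ k d z2 =
        belavinR τ k μ ξ a b c (a + b - c) * thetaA τ k c z1 * thetaA τ k (a + b - c) z2 := by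
    refine Finset.sum_eq_single_of_mem _ (Finset.mem_univ _) fun d _ hne => ?_
    have : a + b ≠ c + d := fun h => hne (by rw [h, add_sub_cancel_left])
    simp [belavinR, this]
  rw [Finset.sum_congr rfl fun c _ => hsum c]
  have hσμ := sigmaE_average hτ a hgenμ hμ0 hz
  have hσξ := sigmaE_average hτ b hgenξ hξ0 hz
  refine mul_left_cancel₀ (mul_ne_zero hk hz') ?_
  have hexp : ∀ P Q R S : ℂ, k * theta1 (z1 - z2 + (μ + ξ) / k) (τ / k) *
      (sigmaE τ μ (z1 - z2 + (μ + ξ) / k) * P * Q - sigmaE τ ξ (z1 - z2 + (μ + ξ) / k) * R * S) =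
      k * theta1 (z1 - z2 + (μ + ξ) / k) (τ / k) * sigmaE τ μ (z1 - z2 + (μ + ξ) / k) * (P * Q) -
      k * theta1 (z1 - z2 + (μ + ξ) / k) (τ / k) * sigmaE τ ξ (z1 - z2 + (μ + ξ) / k) * (R * S) := by
    intros; ring
  rw [hexp, hσμ, hσξ]
  simp only [Finset.mul_sum, Finset.sum_mul]
  rw [← Finset.sum_sub_distrib]
  refine Finset.sum_congr rfl fun c _ => ?_
  have h3 := theta_three_term ((μ - (a.val : ℂ) + (c.val : ℂ)) / k)
    ((ξ - (b.val : ℂ) + (c.val : ℂ)) / k) (z1 - (c.val : ℂ) / k)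
    (z2 - ((a.val : ℂ) + b.val - c.val) / k) hτk
  have hM := hgenμ c
  have hX := hgenξ c
  rw [hd, thetaA_eq_jacobiTheta₂_val, thetaA_eq_jacobiTheta₂_val, thetaA_eq_jacobiTheta₂_val,
    thetaA_eq_jacobiTheta₂_val, thetaA_eq_jacobiTheta₂_val, belavinR, if_pos (by ring), one_mul]
  rw [show z1 + μ / k - (a.val : ℂ) / k =
      z1 - (c.val : ℂ) / k + (μ - (a.val : ℂ) + (c.val : ℂ)) / k by ring,
    show z2 - μ / k - (b.val : ℂ) / k = z2 - ((a.val : ℂ) + b.val - c.val) / k -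
      (μ - (a.val : ℂ) + (c.val : ℂ)) / k by ring,
    show z2 - ξ / k - (a.val : ℂ) / k = z2 - ((a.val : ℂ) + b.val - c.val) / k -
      (ξ - (b.val : ℂ) + (c.val : ℂ)) / k by ring,
    show z1 + ξ / k - (b.val : ℂ) / k =
      z1 - (c.val : ℂ) / k + (ξ - (b.val : ℂ) + (c.val : ℂ)) / k by ring,
    show (μ - ξ - (a.val : ℂ) + b.val) / k = (μ - (a.val : ℂ) + (c.val : ℂ)) / k -
      (ξ - (b.val : ℂ) + (c.val : ℂ)) / k by ring,
    show z1 - z2 + (μ + ξ) / k - (μ - (a.val : ℂ) + (c.val : ℂ)) / k =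
      z1 - (c.val : ℂ) / k - (z2 - ((a.val : ℂ) + b.val - c.val) / k) +
        (ξ - (b.val : ℂ) + (c.val : ℂ)) / k by ring,
    show z1 - z2 + (μ + ξ) / k - (ξ - (b.val : ℂ) + (c.val : ℂ)) / k =
      z1 - (c.val : ℂ) / k - (z2 - ((a.val : ℂ) + b.val - c.val) / k) +
        (μ - (a.val : ℂ) + (c.val : ℂ)) / k by ring,
    show z1 - z2 + (μ + ξ) / k =
      z1 - (c.val : ℂ) / k - (z2 - ((a.val : ℂ) + b.val - c.val) / k) +
        (μ - (a.val : ℂ) + (c.val : ℂ)) / k + (ξ - (b.val : ℂ) + (c.val : ℂ)) / k by ring]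
  generalize (μ - (a.val : ℂ) + (c.val : ℂ)) / k = M at *
  generalize (ξ - (b.val : ℂ) + (c.val : ℂ)) / k = X at *
  generalize z1 - (c.val : ℂ) / k = w₁ at *
  generalize z2 - ((a.val : ℂ) + b.val - c.val) / k = w₂ at *
  generalize τ / (k : ℂ) = σ at *
  rw [show k * theta1 (w₁ - w₂ + M + X) σ * (theta1 (M - X) σ * theta1'0 σ /
      (k * theta1 M σ * theta1 X σ) * jacobiTheta₂ w₁ σ * jacobiTheta₂ w₂ σ) =
      (theta1 (w₁ - w₂ + M + X) σ * theta1 (M - X) σ * (jacobiTheta₂ w₁ σ * jacobiTheta₂ w₂ σ)) *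
        (theta1'0 σ / (theta1 M σ * theta1 X σ)) by field_simp, ← h3]
  field_simp
  ring

/-- the matrix elements of the modified R-operator in the theta basis
are Belavin's ℤ_k-symmetric R-matrix:
R_k(ξ)(θ_a⊗θ_b) = Σ_{c,d∈ℤ_k} R_k(ξ)_{ac,bd} θ_c⊗θ_d, pointwise where the σ's are
defined and for generic μ, ξ. -/
theorem belavin_matrix_elements (τ : ℂ) (hτ : 0 < τ.im) (k : ℕ) [NeZero k]
    (μ ξ : ℂ) (a b : ZMod k)
    (hgenμ : ∀ c : ZMod k, theta1 ((μ - (a.val : ℂ) + (c.val : ℂ)) / k) (τ / k) ≠ 0)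
    (hgenξ : ∀ c : ZMod k, theta1 ((ξ - (b.val : ℂ) + (c.val : ℂ)) / k) (τ / k) ≠ 0)
    (hμ0 : theta1 (-μ) τ ≠ 0) (hξ0 : theta1 (-ξ) τ ≠ 0)
    (z1 z2 : ℂ) (hz : theta1 (z1 - z2 + (μ + ξ) / k) τ ≠ 0) :
    sigmaE τ μ (z1 - z2 + (μ + ξ) / k) *
        thetaA τ k a (z1 + μ / k) * thetaA τ k b (z2 - μ / k) -
      sigmaE τ ξ (z1 - z2 + (μ + ξ) / k) *
        thetaA τ k a (z2 - ξ / k) * thetaA τ k b (z1 + ξ / k) =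
    ∑ c : ZMod k, ∑ d : ZMod k,
      belavinR τ k μ ξ a b c d * thetaA τ k c z1 * thetaA τ k d z2 := by
  have hk0 : (0 : ℝ) < k := by exact_mod_cast NeZero.pos k
  have hτk : 0 < (τ / k).im := by
    rw [← Complex.ofReal_natCast, Complex.div_ofReal_im]
    positivity
  have hθ := (differentiable_theta1 hτ).continuous
  have hA (c : ZMod k) := continuous_thetaA k hτk c
  have hden (ν : ℂ) (hν : theta1 (-ν) τ ≠ 0) :
      ContinuousAt (fun z => sigmaE τ ν (z - z2 + (μ + ξ) / k)) z1 := by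
    have h (w : ℂ) : Continuous fun z => theta1 (z - z2 + (μ + ξ) / k - w) τ :=
      hθ.comp (by fun_prop : Continuous fun z : ℂ => z - z2 + (μ + ξ) / k - w)
    have h0 := h 0
    simp only [sub_zero] at h0
    exact ((h ν).mul continuous_const).continuousAt.div (h0.mul continuous_const).continuousAt
      (mul_ne_zero hz hν)
  have hL : ContinuousAt (fun z => sigmaE τ μ (z - z2 + (μ + ξ) / k) *
        thetaA τ k a (z + μ / k) * thetaA τ k b (z2 - μ / k) -
      sigmaE τ ξ (z - z2 + (μ + ξ) / k) *
        thetaA τ k a (z2 - ξ / k) * thetaA τ k b (z + ξ / k)) z1 := by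
    have h1 := hden μ hμ0
    have h2 := hden ξ hξ0
    have h3 : ContinuousAt (fun z => thetaA τ k a (z + μ / k)) z1 := by fun_prop
    have h4 : ContinuousAt (fun z => thetaA τ k b (z + ξ / k)) z1 := by fun_prop
    exact ((h1.mul h3).mul_const _).sub ((h2.mul_const _).mul h4)
  have hR : ContinuousAt (fun z => ∑ c : ZMod k, ∑ d : ZMod k,
      belavinR τ k μ ξ a b c d * thetaA τ k c z * thetaA τ k d z2) z1 := by
    fun_prop
  have hne : ∀ᶠ z in nhdsWithin z1 {z1}ᶜ, theta1 (z - z2 + (μ + ξ) / k) (τ / k) ≠ 0 := by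
    have hd : Differentiable ℂ fun z => theta1 (z - z2 + (μ + ξ) / k) (τ / k) :=
      (differentiable_theta1 hτk).comp
        (by fun_prop : Differentiable ℂ fun z : ℂ => z - z2 + (μ + ξ) / k)
    refine (hd.analyticAt z1).eventually_eq_zero_or_eventually_ne_zero.resolve_left fun h => ?_
    have h0 := AnalyticOnNhd.eq_of_eventuallyEq (fun z _ => hd.analyticAt z)
      (fun z _ => analyticAt_const) h
    have h1 := congrFun h0 ((μ - (a.val : ℂ) + ((0 : ZMod k).val : ℂ)) / k + z2 - (μ + ξ) / k)
    refine hgenμ 0 ?_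
    rw [← h1]
    congr 1
    ring
  have hz_ev : ∀ᶠ z in nhdsWithin z1 {z1}ᶜ, theta1 (z - z2 + (μ + ξ) / k) τ ≠ 0 := by
    have h : Continuous fun z => theta1 (z - z2 + (μ + ξ) / k) τ :=
      hθ.comp (by fun_prop : Continuous fun z : ℂ => z - z2 + (μ + ξ) / k)
    exact nhdsWithin_le_nhds (h.continuousAt.eventually_ne hz)
  refine tendsto_nhds_unique_of_eventuallyEq
    (hL.tendsto.mono_left (nhdsWithin_le_nhds (s := {z1}ᶜ)))
    (hR.tendsto.mono_left nhdsWithin_le_nhds) ?_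
  filter_upwards [hne, hz_ev] with z h1 h2
  exact belavin_matrix_elements_of_ne_zero hτ a b hgenμ hgenξ hμ0 hξ0 h2 h1
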